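/- If S is an infinite set of positive integers with 1 ∈ S, then H(S) is an accumulation point of D = {H(S') : S' a set of positive integers with 1 ∈ S'} from the left: for every ε > 0 there exists S' ∈ G with H(S) − ε < H(S') < H(S). Consequently, no gap of D has H(S) as its right endpoint. -/

import Mathlib

open scoped Classical

/-- `charFn S` is the characteristic function `u` of a set `S` of positive integers. -/
noncomputable def charFn (S : Set ℕ) (n : ℕ) : ℝ := if n ∈ S then 1 else 0

/-- `H S = ∏_p (1 + Σ_{i ≥ 2} (u(i) - u(i-1)) / p^i)`, the product over all primes. -/
noncomputable def H (S : Set ℕ) : ℝ :=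
  ∏' p : Nat.Primes,
    (1 + ∑' i : ℕ, (charFn S (i + 2) - charFn S (i + 1)) / ((p : ℕ) : ℝ) ^ (i + 2))

/-- The exponentially `S`-numbers: positive integers all of whose prime-factorization
exponents lie in `S`. -/
def ExpS (S : Set ℕ) : Set ℕ :=
  {N | 0 < N ∧ ∀ p : ℕ, p.Prime → p ∣ N → N.factorization p ∈ S}

/-- The set `D` of all densities `H S` as `S` ranges over sets of positive integers
containing `1`. -/
noncomputable def densitySet : Set ℝ :=
  {x | ∃ S : Set ℕ, 1 ∈ S ∧ (∀ n ∈ S, 0 < n) ∧ H S = x}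

/-- The tail `∑_{i ≥ 2} u(i) x^i` of the generating function of `S`. -/
noncomputable def tailSeries (S : Set ℕ) (x : ℝ) : ℝ := ∑' i : ℕ, charFn S (i + 2) * x ^ (i + 2)

/-- The Euler factor of `H S` at `p`. -/
noncomputable def eulerFactor (S : Set ℕ) (p : ℝ) : ℝ :=
  1 + ∑' i : ℕ, (charFn S (i + 2) - charFn S (i + 1)) / p ^ (i + 2)

lemma charFn_nonneg (S : Set ℕ) (n : ℕ) : 0 ≤ charFn S n := by
  unfold charFn; split_ifs <;> norm_num

lemma charFn_le_one (S : Set ℕ) (n : ℕ) : charFn S n ≤ 1 := by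
  unfold charFn; split_ifs <;> norm_num

lemma hasSum_pow_add_two {x : ℝ} (h0 : 0 ≤ x) (hx : x < 1) :
    HasSum (fun i : ℕ => x ^ (i + 2)) (x ^ 2 / (1 - x)) := by
  simpa [pow_add, div_eq_mul_inv, mul_comm] using
    (hasSum_geometric_of_lt_one h0 hx).mul_left (x ^ 2)

lemma summable_tailSeries (S : Set ℕ) {x : ℝ} (h0 : 0 ≤ x) (hx : x < 1) :
    Summable fun i : ℕ => charFn S (i + 2) * x ^ (i + 2) :=
  Summable.of_nonneg_of_le (fun i => mul_nonneg (charFn_nonneg S _) (by positivity))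
    (fun i => mul_le_of_le_one_left (by positivity) (charFn_le_one S _))
    (hasSum_pow_add_two h0 hx).summable

lemma tailSeries_nonneg (S : Set ℕ) {x : ℝ} (h0 : 0 ≤ x) : 0 ≤ tailSeries S x :=
  tsum_nonneg fun i => mul_nonneg (charFn_nonneg S _) (by positivity)

lemma tailSeries_le (S : Set ℕ) {x : ℝ} (h0 : 0 ≤ x) (hx : x < 1) :
    tailSeries S x ≤ x ^ 2 / (1 - x) := by
  rw [← (hasSum_pow_add_two h0 hx).tsum_eq]
  exact (summable_tailSeries S h0 hx).tsum_le_tsum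
    (fun i => mul_le_of_le_one_left (by positivity) (charFn_le_one S _))
    (hasSum_pow_add_two h0 hx).summable

lemma tailSeries_diff_singleton {S : Set ℕ} {m : ℕ} (hm : m + 2 ∈ S) {x : ℝ} (h0 : 0 ≤ x)
    (hx : x < 1) : tailSeries (S \ {m + 2}) x = tailSeries S x - x ^ (m + 2) := by
  have h := (summable_tailSeries S h0 hx).hasSum.sub (hasSum_ite_eq m (x ^ (m + 2)))
  refine Eq.trans (tsum_congr fun i => ?_) h.tsum_eq
  by_cases hi : i = m
  · subst hi
    simp [charFn, hm]
  · simp [charFn, hi]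

lemma eulerFactor_eq {S : Set ℕ} (h1 : 1 ∈ S) {p : ℝ} (hp : 1 < p) :
    eulerFactor S p = 1 - p⁻¹ ^ 2 + (1 - p⁻¹) * tailSeries S p⁻¹ := by
  have h0 : 0 ≤ p⁻¹ := by positivity
  have hx : p⁻¹ < 1 := inv_lt_one_of_one_lt₀ hp
  have hs := summable_tailSeries S h0 hx
  have hshift : HasSum (fun i : ℕ => charFn S (i + 1) * p⁻¹ ^ (i + 1))
      (tailSeries S p⁻¹ + p⁻¹) := by
    have := (hasSum_nat_add_iff (f := fun i : ℕ => charFn S (i + 1) * p⁻¹ ^ (i + 1)) 1).1 hs.hasSum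
    simpa [charFn, h1, tailSeries] using this
  have h := hs.hasSum.sub (hshift.mul_left p⁻¹)
  have heq : (fun i : ℕ => (charFn S (i + 2) - charFn S (i + 1)) / p ^ (i + 2)) = fun i : ℕ =>
      charFn S (i + 2) * p⁻¹ ^ (i + 2) - p⁻¹ * (charFn S (i + 1) * p⁻¹ ^ (i + 1)) := by
    funext i
    rw [div_eq_mul_inv, ← inv_pow]
    ring
  rw [eulerFactor, heq, h.tsum_eq, ← tailSeries]
  ring

lemma eulerFactor_le_one {S : Set ℕ} (h1 : 1 ∈ S) {p : ℝ} (hp : 1 < p) : eulerFactor S p ≤ 1 := by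
  have hx : p⁻¹ < 1 := inv_lt_one_of_one_lt₀ hp
  have h := tailSeries_le S (by positivity : 0 ≤ p⁻¹) hx
  rw [le_div_iff₀ (by linarith)] at h
  rw [eulerFactor_eq h1 hp]
  linarith

lemma le_eulerFactor {S : Set ℕ} (h1 : 1 ∈ S) {p : ℝ} (hp : 1 < p) :
    1 - p⁻¹ ^ 2 ≤ eulerFactor S p := by
  have hx : p⁻¹ < 1 := inv_lt_one_of_one_lt₀ hp
  have h := mul_nonneg (sub_nonneg.2 hx.le) (tailSeries_nonneg S (by positivity : 0 ≤ p⁻¹))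
  rw [eulerFactor_eq h1 hp]
  linarith

lemma eulerFactor_pos {S : Set ℕ} (h1 : 1 ∈ S) {p : ℝ} (hp : 1 < p) : 0 < eulerFactor S p := by
  have hx : p⁻¹ < 1 := inv_lt_one_of_one_lt₀ hp
  have := le_eulerFactor h1 hp
  have := pow_lt_one₀ (by positivity : 0 ≤ p⁻¹) hx two_ne_zero
  linarith

lemma eulerFactor_diff_singleton {S : Set ℕ} (h1 : 1 ∈ S) {m : ℕ} (hm : m + 2 ∈ S) {p : ℝ}
    (hp : 1 < p) :
    eulerFactor (S \ {m + 2}) p = eulerFactor S p - (1 - p⁻¹) * p⁻¹ ^ (m + 2) := by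
  have h1' : 1 ∈ S \ {m + 2} := ⟨h1, by simp⟩
  rw [eulerFactor_eq h1 hp, eulerFactor_eq h1' hp,
    tailSeries_diff_singleton hm (by positivity) (inv_lt_one_of_one_lt₀ hp)]
  ring

lemma Nat.Primes.one_lt_cast (p : Nat.Primes) : (1 : ℝ) < (p : ℕ) :=
  Nat.one_lt_cast.2 p.2.one_lt

lemma summable_primes_inv_sq : Summable fun p : Nat.Primes => ((p : ℕ) : ℝ)⁻¹ ^ 2 := by
  have h : Summable fun n : ℕ => (n : ℝ)⁻¹ ^ 2 := by
    simpa only [inv_pow] using Real.summable_nat_pow_inv.2 one_lt_two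
  exact h.comp_injective Subtype.val_injective

lemma summable_log_eulerFactor {S : Set ℕ} (h1 : 1 ∈ S) :
    Summable fun p : Nat.Primes => Real.log (eulerFactor S (p : ℕ)) := by
  have h : Summable fun p : Nat.Primes => eulerFactor S (p : ℕ) - 1 := by
    refine summable_primes_inv_sq.of_norm_bounded fun p => ?_
    have := le_eulerFactor h1 p.one_lt_cast
    have := eulerFactor_le_one h1 p.one_lt_cast
    rw [Real.norm_eq_abs, abs_le]
    constructor <;> linarith
  simpa using Real.summable_log_one_add_of_summable h

lemma exp_tsum_log_eulerFactor {S : Set ℕ} (h1 : 1 ∈ S) :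
    Real.exp (∑' p : Nat.Primes, Real.log (eulerFactor S (p : ℕ))) = H S :=
  Real.rexp_tsum_eq_tprod (fun p => eulerFactor_pos h1 p.one_lt_cast) (summable_log_eulerFactor h1)

lemma hasProd_eulerFactor {S : Set ℕ} (h1 : 1 ∈ S) :
    HasProd (fun p : Nat.Primes => eulerFactor S (p : ℕ)) (H S) :=
  (Real.multipliable_of_summable_log (fun p : Nat.Primes => eulerFactor_pos h1 p.one_lt_cast)
    (summable_log_eulerFactor h1)).hasProd

lemma H_diff_singleton_lt {S : Set ℕ} (h1 : 1 ∈ S) {m : ℕ} (hm : m + 2 ∈ S) :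
    H (S \ {m + 2}) < H S := by
  have h1' : 1 ∈ S \ {m + 2} := ⟨h1, by simp⟩
  have hlt (p : Nat.Primes) : Real.log (eulerFactor (S \ {m + 2}) (p : ℕ)) <
      Real.log (eulerFactor S (p : ℕ)) := by
    have hp := p.one_lt_cast
    refine Real.log_lt_log (eulerFactor_pos h1' hp) ?_
    rw [eulerFactor_diff_singleton h1 hm hp]
    exact sub_lt_self _ (mul_pos (sub_pos.2 (inv_lt_one_of_one_lt₀ hp)) (by positivity))
  rw [← exp_tsum_log_eulerFactor h1, ← exp_tsum_log_eulerFactor h1', Real.exp_lt_exp]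
  exact Summable.tsum_lt_tsum (i := ⟨2, Nat.prime_two⟩) (fun p => (hlt p).le) (hlt _)
    (summable_log_eulerFactor h1') (summable_log_eulerFactor h1)

lemma Finset.prod_sub_prod_le_sum_sub {ι : Type*} (s : Finset ι) {f g : ι → ℝ}
    (hg : ∀ i, 0 ≤ g i) (hgf : ∀ i, g i ≤ f i) (hf : ∀ i, f i ≤ 1) :
    ∏ i ∈ s, f i - ∏ i ∈ s, g i ≤ ∑ i ∈ s, (f i - g i) := by
  induction s using Finset.induction_on with
  | empty => simp
  | insert a s ha ih =>
    rw [Finset.prod_insert ha, Finset.prod_insert ha, Finset.sum_insert ha]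
    have hG : ∏ i ∈ s, g i ≤ 1 :=
      Finset.prod_le_one (fun i _ => hg i) fun i _ => (hgf i).trans (hf i)
    have hGF : ∏ i ∈ s, g i ≤ ∏ i ∈ s, f i :=
      Finset.prod_le_prod (fun i _ => hg i) fun i _ => hgf i
    nlinarith [mul_nonneg (sub_nonneg.2 (hf a)) (sub_nonneg.2 hGF),
      mul_nonneg (sub_nonneg.2 (hgf a)) (sub_nonneg.2 hG)]

lemma H_sub_H_diff_singleton_le {S : Set ℕ} (h1 : 1 ∈ S) {m : ℕ} (hm : m + 2 ∈ S) :
    H S - H (S \ {m + 2}) ≤ (1 / 2) ^ m * ∑' p : Nat.Primes, ((p : ℕ) : ℝ)⁻¹ ^ 2 := by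
  have h1' : 1 ∈ S \ {m + 2} := ⟨h1, by simp⟩
  have hd (p : Nat.Primes) : eulerFactor S (p : ℕ) - eulerFactor (S \ {m + 2}) (p : ℕ) =
      (1 - ((p : ℕ) : ℝ)⁻¹) * ((p : ℕ) : ℝ)⁻¹ ^ (m + 2) := by
    rw [eulerFactor_diff_singleton h1 hm p.one_lt_cast]
    ring
  refine le_of_tendsto' (Filter.Tendsto.sub (hasProd_eulerFactor h1) (hasProd_eulerFactor h1'))
    fun s => ?_
  refine (s.prod_sub_prod_le_sum_sub (fun p => (eulerFactor_pos h1' p.one_lt_cast).le)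
    (fun p => sub_nonneg.1 ?_) (fun p => eulerFactor_le_one h1 p.one_lt_cast)).trans ?_
  · rw [hd]
    exact mul_nonneg (sub_nonneg.2 (inv_lt_one_of_one_lt₀ p.one_lt_cast).le) (by positivity)
  calc ∑ p ∈ s, (eulerFactor S (p : ℕ) - eulerFactor (S \ {m + 2}) (p : ℕ))
      ≤ ∑ p ∈ s, (1 / 2) ^ m * ((p : ℕ) : ℝ)⁻¹ ^ 2 := by
        refine Finset.sum_le_sum fun p _ => ?_
        have h2 : ((p : ℕ) : ℝ)⁻¹ ≤ 1 / 2 := by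
          rw [one_div]
          exact inv_anti₀ two_pos (by exact_mod_cast p.2.two_le)
        have h0 : 0 ≤ ((p : ℕ) : ℝ)⁻¹ := by positivity
        rw [hd, pow_add]
        refine (mul_le_of_le_one_left (by positivity) (by linarith)).trans ?_
        gcongr
    _ ≤ _ := by
        rw [← Finset.mul_sum]
        gcongr
        exact summable_primes_inv_sq.sum_le_tsum s fun p _ => by positivity

theorem acc_from_left (S : Set ℕ) (h1 : 1 ∈ S) (hpos : ∀ n ∈ S, 0 < n)
    (hinf : S.Infinite) :
    ∀ ε : ℝ, 0 < ε → ∃ S' : Set ℕ, 1 ∈ S' ∧ (∀ n ∈ S', 0 < n) ∧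
      H S - ε < H S' ∧ H S' < H S := by
  intro ε hε
  have ht : Filter.Tendsto
      (fun m : ℕ => (1 / 2 : ℝ) ^ m * ∑' p : Nat.Primes, ((p : ℕ) : ℝ)⁻¹ ^ 2)
      Filter.atTop (nhds 0) := by
    simpa only [zero_mul] using (tendsto_pow_atTop_nhds_zero_of_lt_one (r := (1 / 2 : ℝ)) (by norm_num)
      (by norm_num)).mul_const (∑' p : Nat.Primes, ((p : ℕ) : ℝ)⁻¹ ^ 2)
  obtain ⟨M, hM⟩ := Filter.eventually_atTop.1 (ht.eventually_lt_const hε)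
  obtain ⟨k, hk, hMk⟩ := hinf.exists_gt (M + 2)
  obtain ⟨m, rfl⟩ : ∃ m, k = m + 2 := ⟨k - 2, by omega⟩
  refine ⟨S \ {m + 2}, ⟨h1, by simp⟩, fun n hn => hpos n hn.1, ?_, H_diff_singleton_lt h1 hk⟩
  have := H_sub_H_diff_singleton_le h1 hk
  have := hM m (by omega)
  linarith
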